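/- (Conservation of mass for the stationary Fokker–Planck fixed point, equations (55)–(57) in the proof of Proposition 3.) Let δ > Ū, let μ₀ be a Borel probability measure on Ω, let θ : Ω → ℝ be Borel measurable with 0 ≤ θ(x) ≤ Ū for all x ∈ Ω, and let m be a finite (nonnegative) Borel measure on Ω satisfying m(A) = ∫_A δ / (δ − θ(x) + ∫_Ω θ dm) μ₀(dx) for every Borel set A ⊆ Ω. Then m(Ω) = 1, i.e. m is a probability measure. -/

import Mathlib

open MeasureTheory

/-- The action space `Ω = [0,1] ⊆ ℝ` with its Borel σ-algebra. -/
abbrev Ω : Type := Set.Icc (0:ℝ) 1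

/-- **Conservation of mass for the stationary Fokker–Planck fixed point**
(equations (55)–(57) in the proof of Proposition 3). -/
theorem stmt4
    (Ubar : ℝ) (hUbar : 0 < Ubar)
    (δ : ℝ) (hδ : Ubar < δ)
    (μ0 : Measure Ω) [IsProbabilityMeasure μ0]
    (θ : Ω → ℝ) (hθm : Measurable θ) (hθ : ∀ x, 0 ≤ θ x ∧ θ x ≤ Ubar)
    (m : Measure Ω) [IsFiniteMeasure m]
    (hm : ∀ A : Set Ω, MeasurableSet A →
      m A = ENNReal.ofReal (∫ x in A, δ / (δ - θ x + ∫ z, θ z ∂m) ∂μ0)) :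
    m Set.univ = 1 := by
  set c : ℝ := ∫ z, θ z ∂m with hc
  have hc0 : 0 ≤ c := integral_nonneg fun x => (hθ x).1
  have hpos : ∀ x, 0 < δ - θ x + c := fun x => by linarith [(hθ x).2]
  have hδ0 : 0 < δ := hUbar.trans hδ
  let g : Ω → ℝ := fun x => δ / (δ - θ x + c)
  have hg0 : ∀ x, 0 ≤ g x := fun x => (div_pos hδ0 (hpos x)).le
  have hgm : Measurable g := by
    show Measurable fun x => δ / (δ - θ x + c)
    fun_prop
  have hgb : ∀ x, g x ≤ δ / (δ - Ubar) := fun x =>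
    div_le_div_of_nonneg_left hδ0.le (by linarith) (by linarith [(hθ x).2])
  have hgi : Integrable g μ0 :=
    Integrable.of_bound hgm.aestronglyMeasurable (δ / (δ - Ubar))
      (Filter.Eventually.of_forall fun x => by
        rw [Real.norm_of_nonneg (hg0 x)]; exact hgb x)
  have hti : Integrable (fun x => g x * θ x) μ0 :=
    Integrable.of_bound (hgm.mul hθm).aestronglyMeasurable (δ / (δ - Ubar) * Ubar)
      (Filter.Eventually.of_forall fun x => by
        rw [Real.norm_of_nonneg (mul_nonneg (hg0 x) (hθ x).1)]
        exact mul_le_mul (hgb x) (hθ x).2 (hθ x).1 ((hg0 x).trans (hgb x)))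
  have hmeq : m = μ0.withDensity (fun x => ENNReal.ofReal (g x)) := by
    ext A hA
    rw [hm A hA, withDensity_apply _ hA]
    exact ofReal_integral_eq_lintegral_ofReal hgi.integrableOn
      (Filter.Eventually.of_forall hg0)
  have hcg : c = ∫ x, g x * θ x ∂μ0 := by
    have h : ∫ z, θ z ∂m = ∫ z, θ z ∂(μ0.withDensity (fun x => ENNReal.ofReal (g x))) :=
      congrArg (fun ν : Measure Ω => ∫ z, θ z ∂ν) hmeq
    rw [hc, h, integral_withDensity_eq_integral_toReal_smul hgm.ennreal_ofReal
      (Filter.Eventually.of_forall fun x => ENNReal.ofReal_lt_top)]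
    refine integral_congr_ae (Filter.Eventually.of_forall fun x => ?_)
    simp [ENNReal.toReal_ofReal (hg0 x)]
  have hkey : ∫ x, ((δ + c) * g x - g x * θ x) ∂μ0 = δ := by
    have : ∀ x, (δ + c) * g x - g x * θ x = δ := fun x => by
      have h : g x * (δ - θ x + c) = δ := div_mul_cancel₀ δ (hpos x).ne'
      linarith
    simp [this]
  rw [integral_sub (hgi.const_mul _) hti, integral_const_mul, ← hcg] at hkey
  have hM : ∫ x, g x ∂μ0 = 1 := by
    have h : (δ + c) * ∫ x, g x ∂μ0 = (δ + c) * 1 := by linarith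
    exact mul_left_cancel₀ (by linarith) h
  rw [hm _ MeasurableSet.univ, Measure.restrict_univ]
  change ENNReal.ofReal (∫ x, g x ∂μ0) = 1
  rw [hM, ENNReal.ofReal_one]
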